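/- arXiv:2104.03155 — 2 statements merged into one kernel-verified Lean document; each statement's English description precedes it below -/
import Mathlib

section
/- Let α, β > 0 and 0 < τ_min ≤ τ_max be constants. Let τ : [0,∞) → ℝ be differentiable with τ_min ≤ τ(t) ≤ τ_max for all t ≥ 0, with τ' bounded on [0,∞) and square-integrable on [0,∞). Let d : [0,∞) → ℝ be measurable and bounded. Then every twice continuously differentiable solution y : [0,∞) → ℝ of the equation τ(t)² y''(t) = -α β y(t) - α τ(t) y'(t) + τ(t)² d(t) has both y and y' bounded on [0,∞). -/
/-- A nonnegative function whose logarithmic growth rate is dominated by an integrable function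
wherever it exceeds some threshold is bounded above. -/
lemma exists_forall_le_of_deriv_le_mul {V V' φ : ℝ → ℝ} (m : ℝ)
    (hV : ∀ t ∈ Set.Ici (0:ℝ), HasDerivWithinAt V (V' t) (Set.Ici 0) t)
    (hV_nonneg : ∀ t, 0 ≤ V t) (hφ_nonneg : ∀ t, 0 ≤ φ t)
    (hφ : MeasureTheory.IntegrableOn φ (Set.Ici 0))
    (hle : ∀ t ∈ Set.Ici (0:ℝ), m ≤ V t → V' t ≤ φ t * V t) :
    ∃ M, ∀ t ∈ Set.Ici (0:ℝ), V t ≤ M := by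
  set m' := max m (V 0)
  set K := ∫ t in Set.Ici (0:ℝ), φ t
  refine ⟨Real.exp (Real.log (1 + m') + K), fun t ht => ?_⟩
  have ht0 : (0:ℝ) ≤ t := ht
  have hm'0 : 0 ≤ m' := (hV_nonneg 0).trans (le_max_right _ _)
  have hVc : ContinuousOn V (Set.Ici 0) := fun x hx => (hV x hx).continuousWithinAt
  have hcpt : IsCompact (Set.Icc 0 t ∩ V ⁻¹' Set.Iic m') :=
    isCompact_Icc.of_isClosed_subset
      ((hVc.mono Set.Icc_subset_Ici_self).preimage_isClosed_of_isClosed isClosed_Icc isClosed_Iic)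
      Set.inter_subset_left
  obtain ⟨s, ⟨⟨hs0, hst⟩, hsV⟩, hs⟩ :=
    hcpt.exists_isGreatest ⟨0, ⟨le_rfl, ht0⟩, le_max_right m (V 0)⟩
  have hgt : ∀ x ∈ Set.Ioo s t, m ≤ V x := by
    intro x hx
    by_contra! h
    exact absurd (hs ⟨⟨hs0.trans hx.1.le, hx.2.le⟩, h.le.trans (le_max_left _ _)⟩)
      (not_le.mpr hx.1)
  have hsub : Set.Icc s t ⊆ Set.Ici 0 := fun x hx => hs0.trans hx.1
  have hpos : ∀ x, 0 < 1 + V x := fun x => by linarith [hV_nonneg x]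
  have hlog : Real.log (1 + V t) - Real.log (1 + V s) ≤ ∫ x in s..t, φ x := by
    refine intervalIntegral.sub_le_integral_of_hasDeriv_right_of_le
      (g := fun x => Real.log (1 + V x)) (g' := fun x => V' x / (1 + V x)) hst ?_ ?_
      (hφ.mono_set hsub) ?_
    · exact ((hVc.mono hsub).const_add 1).log fun x _ => (hpos x).ne'
    · intro x hx
      have hx0 : 0 ≤ x := hs0.trans hx.1.le
      exact (((hV x hx0).const_add 1).log (hpos x).ne').mono
        fun z hz => hx0.trans (Set.mem_Ioi.1 hz).le
    · intro x hx
      rw [div_le_iff₀ (hpos x)]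
      linarith [hle x (hs0.trans hx.1.le) (hgt x hx), hφ_nonneg x]
  have hint : ∫ x in s..t, φ x ≤ K := by
    rw [intervalIntegral.integral_of_le hst]
    exact MeasureTheory.setIntegral_mono_set hφ (Filter.Eventually.of_forall hφ_nonneg)
      (Set.Ioc_subset_Icc_self.trans hsub).eventuallyLE
  have hlogs : Real.log (1 + V s) ≤ Real.log (1 + m') :=
    Real.log_le_log (hpos s) (by linarith [show V s ≤ m' from hsV])
  have := (Real.log_le_iff_le_exp (hpos t)).1
    (show Real.log (1 + V t) ≤ Real.log (1 + m') + K by linarith)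
  linarith

/-- Dissipation estimate for the quadratic form `(αβ + α²/4) y² + (α/2 y + z)²` along
`(z, -αβ y - α z + p z + f)`, with a multiplicative perturbation `p` and a forcing term `f`. -/
lemma lyapunov_dissipation {α β : ℝ} (hα : 0 < α) (hβ : 0 < β) :
    ∃ ε > 0, ∀ y z p f : ℝ,
      2 * (α * β + α ^ 2 / 4) * y * z
          + 2 * (α / 2 * y + z) * (α / 2 * z + p * z - α * β * y - α * z + f) ≤
        (-2 * ε + 4 * p ^ 2 / ε) * ((α * β + α ^ 2 / 4) * y ^ 2 + (α / 2 * y + z) ^ 2)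
          + f ^ 2 / ε := by
  set a := α * β + α ^ 2 / 4 with ha
  have ha0 : 0 < a := by positivity
  have hb0 : 0 < a + α ^ 2 / 2 := by positivity
  set ε := min (α ^ 2 * β / (a + α ^ 2 / 2)) (α / 2) / 4 with hε
  have hε0 : 0 < ε := by positivity
  have h1 : 4 * ε * (a + α ^ 2 / 2) ≤ α ^ 2 * β := by
    rw [← le_div_iff₀ hb0]
    linarith [min_le_left (α ^ 2 * β / (a + α ^ 2 / 2)) (α / 2)]
  have h2 : 4 * ε * 2 ≤ α := by
    linarith [min_le_right (α ^ 2 * β / (a + α ^ 2 / 2)) (α / 2)]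
  refine ⟨ε, hε0, fun y z p f => ?_⟩
  set u := α / 2 * y + z with hu
  have young : ∀ x w : ℝ, 2 * x * w ≤ ε * x ^ 2 + w ^ 2 / ε := by
    intro x w
    have h : ε * x ^ 2 + w ^ 2 / ε - 2 * x * w = (ε * x - w) ^ 2 / ε := by
      field_simp
      ring
    have : 0 ≤ (ε * x - w) ^ 2 / ε := by positivity
    linarith
  have hz : z ^ 2 ≤ 4 * (a * y ^ 2 + u ^ 2) := by
    have : 0 ≤ α * β * y ^ 2 := by positivity
    have hzu : z = u - α / 2 * y := by rw [hu]; ring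
    rw [hzu, ha]
    nlinarith [sq_nonneg (α * y), sq_nonneg u]
  have hzp : (p * z) ^ 2 / ε ≤ 4 * p ^ 2 / ε * (a * y ^ 2 + u ^ 2) := by
    rw [div_mul_eq_mul_div]
    gcongr
    nlinarith [mul_le_mul_of_nonneg_left hz (sq_nonneg p)]
  have hdiss : 4 * ε * (a * y ^ 2 + u ^ 2) ≤ α ^ 2 * β * y ^ 2 + α * z ^ 2 := by
    have hu2 : u ^ 2 ≤ α ^ 2 / 2 * y ^ 2 + 2 * z ^ 2 := by
      rw [hu]
      nlinarith [sq_nonneg (α / 2 * y - z)]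
    calc 4 * ε * (a * y ^ 2 + u ^ 2)
        ≤ 4 * ε * (a * y ^ 2 + (α ^ 2 / 2 * y ^ 2 + 2 * z ^ 2)) := by gcongr
      _ = 4 * ε * (a + α ^ 2 / 2) * y ^ 2 + 4 * ε * 2 * z ^ 2 := by ring
      _ ≤ α ^ 2 * β * y ^ 2 + α * z ^ 2 := by gcongr
  have hεa : 0 ≤ ε * (a * y ^ 2) := by positivity
  have heq : 2 * a * y * z + 2 * u * (α / 2 * z + p * z - α * β * y - α * z + f) =
      -(α ^ 2 * β * y ^ 2 + α * z ^ 2) + 2 * u * (p * z) + 2 * u * f := by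
    rw [hu, ha]
    ring
  rw [heq]
  linarith [young u (p * z), young u f]

/-- Scalar reduction of the boundedness part of Theorem 1.
Let `α, β > 0`, `0 < τmin ≤ τmax`. Let `τ : [0,∞) → ℝ` be differentiable with
`τmin ≤ τ t ≤ τmax`, `τ'` bounded and square-integrable on `[0,∞)`. Let `d` be
measurable and bounded. Then every twice continuously differentiable solution
`y` of `τ(t)² y'' = -αβ y - α τ(t) y' + τ(t)² d(t)` has `y` and `y'` bounded. -/
theorem scalar_reference_model_bounded
    (α β τmin τmax : ℝ) (hα : 0 < α) (hβ : 0 < β)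
    (hτmin : 0 < τmin) (hττ : τmin ≤ τmax)
    (τ τ' : ℝ → ℝ)
    (hτderiv : ∀ t ∈ Set.Ici (0:ℝ), HasDerivWithinAt τ (τ' t) (Set.Ici 0) t)
    (hτbd : ∀ t ∈ Set.Ici (0:ℝ), τmin ≤ τ t ∧ τ t ≤ τmax)
    (hτ'bdd : ∃ C, ∀ t ∈ Set.Ici (0:ℝ), |τ' t| ≤ C)
    (hτ'L2 : MeasureTheory.IntegrableOn (fun t => (τ' t) ^ 2) (Set.Ici 0))
    (d : ℝ → ℝ) (hdmeas : Measurable d)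
    (hdbdd : ∃ D, ∀ t ∈ Set.Ici (0:ℝ), |d t| ≤ D)
    (y y' y'' : ℝ → ℝ)
    (hy' : ∀ t ∈ Set.Ici (0:ℝ), HasDerivWithinAt y (y' t) (Set.Ici 0) t)
    (hy'' : ∀ t ∈ Set.Ici (0:ℝ), HasDerivWithinAt y' (y'' t) (Set.Ici 0) t)
    (hy''cont : ContinuousOn y'' (Set.Ici 0))
    (hode : ∀ t ∈ Set.Ici (0:ℝ),
      (τ t) ^ 2 * y'' t = -(α * β) * y t - α * τ t * y' t + (τ t) ^ 2 * d t) :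
    (∃ M, ∀ t ∈ Set.Ici (0:ℝ), |y t| ≤ M) ∧
    (∃ M, ∀ t ∈ Set.Ici (0:ℝ), |y' t| ≤ M) := by
  obtain ⟨D, hD⟩ := hdbdd
  obtain ⟨ε, hε, hdiss⟩ := lyapunov_dissipation hα hβ
  set a := α * β + α ^ 2 / 4 with ha
  have ha0 : 0 < a := by positivity
  have hτpos : ∀ t ∈ Set.Ici (0:ℝ), 0 < τ t := fun t ht => hτmin.trans_le (hτbd t ht).1
  set E := (τmax ^ 2 * D) ^ 2 / ε
  set V : ℝ → ℝ := fun t => a * y t ^ 2 + (α / 2 * y t + τ t * y' t) ^ 2 with hVdef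
  have hV_nonneg : ∀ t, 0 ≤ V t := fun t => by positivity
  obtain ⟨M, hM⟩ : ∃ M, ∀ t ∈ Set.Ici (0:ℝ), V t ≤ M := by
    refine exists_forall_le_of_deriv_le_mul (φ := fun t => 4 / (ε * τmin) * τ' t ^ 2)
      (V' := fun t => 2 * a * y t * y' t + 2 * (α / 2 * y t + τ t * y' t) *
        (α / 2 * y' t + (τ' t * y' t + τ t * y'' t)))
      (E / (2 * ε)) ?_ hV_nonneg (fun t => by positivity) (hτ'L2.const_mul _) ?_
    · intro t ht
      refine ((((hy' t ht).pow 2).const_mul a).add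
        ((((hy' t ht).const_mul (α / 2)).add ((hτderiv t ht).mul (hy'' t ht))).pow 2)).congr_deriv ?_
      simp
      ring
    · intro t ht hEV
      have hτt := hτpos t ht
      have hd2 : (τ t ^ 2 * d t) ^ 2 / ε ≤ E := by
        have h : |τ t ^ 2 * d t| ≤ τmax ^ 2 * D := by
          rw [abs_mul, abs_of_nonneg (sq_nonneg (τ t))]
          have := (hτbd t ht).2
          have := hD t ht
          gcongr
        exact div_le_div_of_nonneg_right (sq_le_sq' (abs_le.1 h).1 (abs_le.1 h).2) hε.le
      have hE : E ≤ 2 * ε * V t := by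
        rw [div_le_iff₀ (by positivity)] at hEV
        linarith
      have hkey := hdiss (y t) (τ t * y' t) (τ' t) (τ t ^ 2 * d t)
      have hode_t := hode t ht
      rw [← mul_le_mul_iff_right₀ hτt]
      calc _ = 2 * a * y t * (τ t * y' t) + 2 * (α / 2 * y t + τ t * y' t) *
            (α / 2 * (τ t * y' t) + τ' t * (τ t * y' t) - α * β * y t
              - α * (τ t * y' t) + τ t ^ 2 * d t) := by
              linear_combination 2 * (α / 2 * y t + τ t * y' t) * hode_t
        _ ≤ 4 * τ' t ^ 2 / ε * V t := by
              simp only [hVdef] at hE ⊢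
              linarith
        _ = τmin * (4 / (ε * τmin) * τ' t ^ 2 * V t) := by
              field_simp
        _ ≤ τ t * (4 / (ε * τmin) * τ' t ^ 2 * V t) := by
              have := hV_nonneg t
              have := (hτbd t ht).1
              gcongr
  refine ⟨⟨√(M / a), fun t ht => Real.abs_le_sqrt ?_⟩,
    ⟨√(4 * M / τmin ^ 2), fun t ht => Real.abs_le_sqrt ?_⟩⟩
  · rw [le_div_iff₀ ha0]
    have := hM t ht
    simp only [hVdef] at this
    linarith [sq_nonneg (α / 2 * y t + τ t * y' t)]
  · rw [le_div_iff₀ (by positivity)]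
    have hVM := hM t ht
    simp only [hVdef, ha] at hVM
    have hz : (τ t * y' t) ^ 2 ≤ 4 * M := by
      have : 0 ≤ α * β * y t ^ 2 := by positivity
      nlinarith [sq_nonneg (α * y t + τ t * y' t), sq_nonneg (α / 2 * y t + τ t * y' t),
        sq_nonneg (α * y t)]
    have hτ2 : τmin ^ 2 ≤ τ t ^ 2 := by
      have := (hτbd t ht).1
      gcongr
    calc y' t ^ 2 * τmin ^ 2 ≤ y' t ^ 2 * τ t ^ 2 := by gcongr
      _ = (τ t * y' t) ^ 2 := by ring
      _ ≤ 4 * M := hz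
end

section
/- Let α, β > 0 and 0 < τ_min ≤ τ_max be constants. Let τ : [0,∞) → ℝ be differentiable with τ_min ≤ τ(t) ≤ τ_max for all t ≥ 0, with τ' bounded and square-integrable on [0,∞). Let d : [0,∞) → ℝ³ be measurable and bounded. Then every twice continuously differentiable solution q : [0,∞) → ℝ³ of the system τ(t)² q''(t) = -α β q(t) - α τ(t) q'(t) + τ(t)² d(t) has both q and q' bounded on [0,∞). -/
open Set MeasureTheory

/-- A nonnegative-rate Grönwall bound: if `V' ≤ ψ V` whenever `V` is above a positive threshold
and `ψ` is integrable on `[0, ∞)`, then `V` is bounded above on `[0, ∞)`. -/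
theorem exists_upper_bound_of_deriv_le_mul {V V' ψ : ℝ → ℝ} {m : ℝ} (hm : 0 < m)
    (hV : ∀ t ∈ Ici (0 : ℝ), HasDerivWithinAt V (V' t) (Ici 0) t)
    (hψ : IntegrableOn ψ (Ici 0)) (hψ0 : ∀ t, 0 ≤ ψ t)
    (h : ∀ t ∈ Ici (0 : ℝ), m ≤ V t → V' t ≤ ψ t * V t) :
    ∃ K, ∀ t ∈ Ici (0 : ℝ), V t ≤ K := by
  set M := max m (V 0) with hM
  set S := ∫ t in Ici (0 : ℝ), ψ t with hS
  have hS0 : 0 ≤ S := integral_nonneg hψ0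
  have hM0 : 0 < M := lt_max_of_lt_left hm
  refine ⟨M * Real.exp S, fun t ht => ?_⟩
  have hcont : ContinuousOn V (Ici 0) := fun s hs => (hV s hs).continuousWithinAt
  have hsub : Icc 0 t ⊆ Ici (0 : ℝ) := fun _ hs => hs.1
  obtain ⟨s, ⟨hs, hsM⟩, hlast⟩ : ∃ s, IsGreatest (Icc 0 t ∩ V ⁻¹' Iic M) s :=
    (isCompact_Icc.of_isClosed_subset
      ((hcont.mono hsub).preimage_isClosed_of_isClosed isClosed_Icc isClosed_Iic)
      inter_subset_left).exists_isGreatest ⟨0, ⟨le_rfl, ht⟩, le_max_right m (V 0)⟩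
  have habove : ∀ x, s < x → x ≤ t → M < V x := fun x hsx hxt => by
    by_contra! hx
    exact absurd (hlast ⟨⟨hs.1.trans hsx.le, hxt⟩, hx⟩) (not_le.2 hsx)
  have hst : s ≤ t := hs.2
  have hsub' : Icc s t ⊆ Ici (0 : ℝ) := fun _ hx => hs.1.trans hx.1
  rcases hst.eq_or_lt with rfl | hlt
  · exact (show V s ≤ M from hsM).trans
      (le_mul_of_one_le_right hM0.le (Real.one_le_exp hS0))
  have hVs : V s = M := by
    refine le_antisymm hsM ?_
    have hc : ContinuousWithinAt V (Ioc s t) s :=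
      (hcont s hs.1).mono (Ioc_subset_Icc_self.trans hsub')
    have : (nhdsWithin s (Ioc s t)).NeBot := left_nhdsWithin_Ioc_neBot hlt
    exact ge_of_tendsto hc (eventually_nhdsWithin_of_forall fun x hx => (habove x hx.1 hx.2).le)
  have hpos : ∀ x ∈ Icc s t, 0 < V x := fun x hx => by
    rcases hx.1.eq_or_lt with rfl | hsx
    · exact hVs ▸ hM0
    · exact hM0.trans (habove x hsx hx.2)
  have hlog : Real.log (V t) - Real.log (V s) ≤ ∫ x in s..t, ψ x := by
    refine intervalIntegral.sub_le_integral_of_hasDeriv_right_of_le (g' := fun x => V' x / V x) hst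
      ((hcont.mono hsub').log fun x hx => (hpos x hx).ne') (fun x hx => ?_)
      (hψ.mono_set hsub') (fun x hx => ?_)
    · have hx' := Ioo_subset_Icc_self hx
      have hx0 : 0 ≤ x := hsub' hx'
      have hIoi : Ioi x ⊆ Ici 0 := Ioi_subset_Ici_self.trans (Ici_subset_Ici.2 hx0)
      exact ((hV x hx0).mono hIoi).log (hpos x hx').ne'
    · have hx' := Ioo_subset_Icc_self hx
      exact (div_le_iff₀ (hpos x hx')).2
        (h x (hsub' hx') ((le_max_left m (V 0)).trans (habove x hx.1 hx.2.le).le))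
  have hint : ∫ x in s..t, ψ x ≤ S := by
    rw [intervalIntegral.integral_of_le hst]
    exact setIntegral_mono_set hψ (.of_forall hψ0)
      (Ioc_subset_Icc_self.trans hsub').eventuallyLE
  have hVt := hpos t ⟨hst, le_rfl⟩
  rw [hVs] at hlog
  calc V t = Real.exp (Real.log (V t)) := (Real.exp_log hVt).symm
    _ ≤ Real.exp (Real.log M + S) := Real.exp_le_exp.2 (by linarith)
    _ = M * Real.exp S := by rw [Real.exp_add, Real.exp_log hM0]

section Lyapunov

variable {E : Type*} [NormedAddCommGroup E] [InnerProductSpace ℝ E]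

/-- A Lyapunov function of the reference model, in terms of the position `x` and the scaled
velocity `p`. -/
noncomputable def lyapunov (α β : ℝ) (x p : E) : ℝ :=
  α * β * ‖x‖ ^ 2 + (1 / 2) * ‖p‖ ^ 2 + (1 / 2) * ‖p + α • x‖ ^ 2

theorem lyapunov_le {α β : ℝ} (hα : 0 < α) (hβ : 0 < β) (x p : E) :
    lyapunov α β x p ≤ (α * β + α ^ 2 + 3 / 2) * (‖x‖ ^ 2 + ‖p‖ ^ 2) := by
  have h1 : ‖p + α • x‖ ^ 2 ≤ (‖p‖ + α * ‖x‖) ^ 2 := by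
    gcongr
    exact (norm_add_le _ _).trans_eq (by rw [norm_smul, Real.norm_of_nonneg hα.le])
  have h2 := mul_nonneg (mul_pos hα hβ).le (sq_nonneg ‖p‖)
  have h3 := mul_nonneg (sq_nonneg α) (sq_nonneg ‖p‖)
  unfold lyapunov
  nlinarith [sq_nonneg (‖p‖ - α * ‖x‖), sq_nonneg ‖x‖, sq_nonneg ‖p‖]

theorem le_lyapunov (α β : ℝ) (x p : E) :
    min (α * β) (1 / 2) * (‖x‖ ^ 2 + ‖p‖ ^ 2) ≤ lyapunov α β x p := by
  have h1 := mul_le_mul_of_nonneg_right (min_le_left (α * β) (1 / 2)) (sq_nonneg ‖x‖)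
  have h2 := mul_le_mul_of_nonneg_right (min_le_right (α * β) (1 / 2)) (sq_nonneg ‖p‖)
  unfold lyapunov
  nlinarith [sq_nonneg ‖p + α • x‖]

/-- The derivative of `lyapunov` along trajectories, where `x` is the position, `p` the scaled
velocity, `T` the time scaling, `T'` its derivative and `w` the disturbance. -/
noncomputable def lyapunovDeriv (α β T T' : ℝ) (x p w : E) : ℝ :=
  -(α / T) * ‖p‖ ^ 2 - α ^ 2 * β / T * ‖x‖ ^ 2
    + T' / T * (2 * ‖p‖ ^ 2 + α * inner ℝ x p) + T * (2 * inner ℝ p w + α * inner ℝ x w)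

theorem hasDerivWithinAt_lyapunov {α β : ℝ} {τ τ' : ℝ → ℝ} {q q' q'' : ℝ → E} {w : E}
    {s : Set ℝ} {t : ℝ} (hτ0 : τ t ≠ 0) (hτ : HasDerivWithinAt τ (τ' t) s t)
    (hq : HasDerivWithinAt q (q' t) s t) (hq' : HasDerivWithinAt q' (q'' t) s t)
    (hode : (τ t) ^ 2 • q'' t = -((α * β) • q t) - (α * τ t) • q' t + (τ t) ^ 2 • w) :
    HasDerivWithinAt (fun u => lyapunov α β (q u) (τ u • q' u))
      (lyapunovDeriv α β (τ t) (τ' t) (q t) (τ t • q' t) w) s t := by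
  have hq''t : q'' t = ((τ t) ^ 2)⁻¹ • (-((α * β) • q t) - (α * τ t) • q' t + (τ t) ^ 2 • w) := by
    rw [← hode, smul_smul, inv_mul_cancel₀ (pow_ne_zero 2 hτ0), one_smul]
  have hp := hτ.smul hq'
  have h := ((hq.norm_sq.const_mul (α * β)).add (hp.norm_sq.const_mul (1 / 2))).add
    ((hp.add (hq.const_smul α)).norm_sq.const_mul (1 / 2))
  refine h.congr_deriv ?_
  simp only [lyapunovDeriv, hq''t, Pi.add_apply, Pi.smul_apply, Pi.smul_apply', inner_add_left,
    inner_add_right, inner_sub_right, inner_neg_right, real_inner_smul_left, real_inner_smul_right,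
    ← real_inner_self_eq_norm_sq, real_inner_comm (q t) (q' t)]
  field_simp
  ring

theorem lyapunovDeriv_le {α β T T' a b D : ℝ} {x p w : E} (hα : 0 < α)
    (ha : 0 < a) (haT : a ≤ T) (hTb : T ≤ b) (hw : ‖w‖ ≤ D) {m : ℝ} (hm : 0 < m)
    (hm1 : m * b ≤ α) (hm2 : m * b ≤ α ^ 2 * β) :
    lyapunovDeriv α β T T' x p w ≤ (((2 + α) / a) ^ 2 / m * T' ^ 2 - m / 2) * (‖x‖ ^ 2 + ‖p‖ ^ 2)
      + (b * D) ^ 2 * (4 + α ^ 2) / m := by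
  have hT : 0 < T := ha.trans_le haT
  have hD : 0 ≤ D := (norm_nonneg w).trans hw
  have hdamp₁ : m ≤ α / T :=
    (le_div_iff₀ hT).2 ((mul_le_mul_of_nonneg_left hTb hm.le).trans hm1)
  have hdamp₂ : m ≤ α ^ 2 * β / T :=
    (le_div_iff₀ hT).2 ((mul_le_mul_of_nonneg_left hTb hm.le).trans hm2)
  have hxp : |inner ℝ x p| ≤ ‖x‖ ^ 2 + ‖p‖ ^ 2 :=
    (abs_real_inner_le_norm x p).trans (by nlinarith [sq_nonneg (‖x‖ - ‖p‖), sq_nonneg (‖x‖ + ‖p‖)])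
  have hscale : T' / T * (2 * ‖p‖ ^ 2 + α * inner ℝ x p) ≤
      ((2 + α) / a) * |T'| * (‖x‖ ^ 2 + ‖p‖ ^ 2) := by
    calc T' / T * (2 * ‖p‖ ^ 2 + α * inner ℝ x p)
        ≤ |T'| / T * |2 * ‖p‖ ^ 2 + α * inner ℝ x p| := by
          rw [← abs_of_pos hT, ← abs_div, abs_of_pos hT, ← abs_mul]; exact le_abs_self _
      _ ≤ |T'| / a * ((2 + α) * (‖x‖ ^ 2 + ‖p‖ ^ 2)) := by
          gcongr
          refine (abs_add_le _ _).trans ?_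
          rw [abs_mul α, abs_of_pos hα, abs_of_nonneg (by positivity : 0 ≤ 2 * ‖p‖ ^ 2)]
          nlinarith [mul_le_mul_of_nonneg_left hxp hα.le, sq_nonneg ‖x‖]
      _ = _ := by ring
  have hyoung : ∀ y z : ℝ, y * z ≤ m / 4 * y ^ 2 + z ^ 2 / m := fun y z => by
    have : m / 4 * y ^ 2 + z ^ 2 / m - y * z = (m * y / 2 - z) ^ 2 / m := by
      field_simp; ring
    have : 0 ≤ (m * y / 2 - z) ^ 2 / m := by positivity
    linarith
  have hrate := hyoung 1 ((2 + α) / a * |T'|)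
  rw [mul_pow, sq_abs] at hrate
  have hrate' := mul_le_mul_of_nonneg_right hrate (by positivity : 0 ≤ ‖x‖ ^ 2 + ‖p‖ ^ 2)
  have hforce : T * (2 * inner ℝ p w + α * inner ℝ x w) ≤
      ‖p‖ * (2 * (b * D)) + ‖x‖ * (α * (b * D)) := by
    have hpw : inner ℝ p w ≤ ‖p‖ * D := (real_inner_le_norm p w).trans (by gcongr)
    have hxw : inner ℝ x w ≤ ‖x‖ * D := (real_inner_le_norm x w).trans (by gcongr)
    calc T * (2 * inner ℝ p w + α * inner ℝ x w) ≤ T * (2 * (‖p‖ * D) + α * (‖x‖ * D)) := by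
          gcongr
      _ ≤ b * (2 * (‖p‖ * D) + α * (‖x‖ * D)) := by gcongr
      _ = _ := by ring
  have h1 := hyoung ‖p‖ (2 * (b * D))
  have h2 := hyoung ‖x‖ (α * (b * D))
  have h3 := mul_le_mul_of_nonneg_right hdamp₁ (sq_nonneg ‖p‖)
  have h4 := mul_le_mul_of_nonneg_right hdamp₂ (sq_nonneg ‖x‖)
  have e1 : (b * D) ^ 2 * (4 + α ^ 2) / m = (2 * (b * D)) ^ 2 / m + (α * (b * D)) ^ 2 / m := by ring
  have e2 : ((2 + α) / a) ^ 2 * T' ^ 2 / m = ((2 + α) / a) ^ 2 / m * T' ^ 2 := by ring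
  rw [e2] at hrate'
  rw [lyapunovDeriv, e1]
  linarith

end Lyapunov


/-- Vector form (equation (15) of the paper) of the boundedness
part of Theorem 1. Let `α, β > 0`, `0 < τmin ≤ τmax`. Let `τ : [0,∞) → ℝ` be
differentiable with `τmin ≤ τ t ≤ τmax`, `τ'` bounded and square-integrable on
`[0,∞)`. Let `d : [0,∞) → ℝ³` be measurable and bounded. Then every twice
continuously differentiable solution `q` of
`τ(t)² q'' = -αβ q - α τ(t) q' + τ(t)² d(t)` has `q` and `q'` bounded. -/
theorem vector_reference_model_bounded
    (α β τmin τmax : ℝ) (hα : 0 < α) (hβ : 0 < β)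
    (hτmin : 0 < τmin) (hττ : τmin ≤ τmax)
    (τ τ' : ℝ → ℝ)
    (hτderiv : ∀ t ∈ Set.Ici (0:ℝ), HasDerivWithinAt τ (τ' t) (Set.Ici 0) t)
    (hτbd : ∀ t ∈ Set.Ici (0:ℝ), τmin ≤ τ t ∧ τ t ≤ τmax)
    (hτ'bdd : ∃ C, ∀ t ∈ Set.Ici (0:ℝ), |τ' t| ≤ C)
    (hτ'L2 : MeasureTheory.IntegrableOn (fun t => (τ' t) ^ 2) (Set.Ici 0))
    (d : ℝ → EuclideanSpace ℝ (Fin 3)) (hdmeas : Measurable d)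
    (hdbdd : ∃ D, ∀ t ∈ Set.Ici (0:ℝ), ‖d t‖ ≤ D)
    (q q' q'' : ℝ → EuclideanSpace ℝ (Fin 3))
    (hq' : ∀ t ∈ Set.Ici (0:ℝ), HasDerivWithinAt q (q' t) (Set.Ici 0) t)
    (hq'' : ∀ t ∈ Set.Ici (0:ℝ), HasDerivWithinAt q' (q'' t) (Set.Ici 0) t)
    (hq''cont : ContinuousOn q'' (Set.Ici 0))
    (hode : ∀ t ∈ Set.Ici (0:ℝ),
      (τ t) ^ 2 • q'' t = -((α * β) • q t) - (α * τ t) • q' t + (τ t) ^ 2 • d t) :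
    (∃ M, ∀ t ∈ Set.Ici (0:ℝ), ‖q t‖ ≤ M) ∧
    (∃ M, ∀ t ∈ Set.Ici (0:ℝ), ‖q' t‖ ≤ M) := by
  obtain ⟨D, hD⟩ := hdbdd
  have hb : 0 < τmax := hτmin.trans_le hττ
  set m := min α (α ^ 2 * β) / τmax with hmdef
  have hm : 0 < m := by positivity
  have hmb : m * τmax = min α (α ^ 2 * β) := div_mul_cancel₀ _ hb.ne'
  set k := ((2 + α) / τmin) ^ 2 / m with hk
  have hk0 : 0 ≤ k := by positivity
  set F := (τmax * D) ^ 2 * (4 + α ^ 2) / m with hF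
  have hF0 : 0 ≤ F := by positivity
  set c₁ := min (α * β) (1 / 2) with hc₁
  have hc₁0 : 0 < c₁ := by positivity
  set c₂ := α * β + α ^ 2 + 3 / 2 with hc₂
  have hc₂0 : 0 < c₂ := by positivity
  have hτ0 : ∀ t ∈ Set.Ici (0 : ℝ), 0 < τ t := fun t ht => hτmin.trans_le (hτbd t ht).1
  obtain ⟨K, hK⟩ := exists_upper_bound_of_deriv_le_mul
    (V := fun t => lyapunov α β (q t) (τ t • q' t)) (ψ := fun t => k / c₁ * τ' t ^ 2)
    (m := c₂ * (2 * F / m) + 1) (by positivity)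
    (fun t ht => hasDerivWithinAt_lyapunov (hτ0 t ht).ne' (hτderiv t ht) (hq' t ht) (hq'' t ht)
      (hode t ht)) (hτ'L2.const_mul _) (fun t => by positivity) (fun t ht hVt => by
      have hderiv := lyapunovDeriv_le (T' := τ' t) (x := q t) (p := τ t • q' t) hα hτmin
        (hτbd t ht).1 (hτbd t ht).2 (hD t ht) hm (hmb.trans_le (min_le_left _ _))
        (hmb.trans_le (min_le_right _ _))
      have hup := lyapunov_le hα hβ (q t) (τ t • q' t)
      have hlow := le_lyapunov α β (q t) (τ t • q' t)
      rw [← hk, ← hF] at hderiv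
      rw [← hc₂] at hup
      rw [← hc₁] at hlow
      set N := ‖q t‖ ^ 2 + ‖τ t • q' t‖ ^ 2
      have hN : 2 * F / m ≤ N := le_of_mul_le_mul_left (by linarith) hc₂0
      rw [div_le_iff₀ hm] at hN
      have hlow' := mul_le_mul_of_nonneg_left hlow (by positivity : 0 ≤ k / c₁ * τ' t ^ 2)
      have e : k / c₁ * τ' t ^ 2 * (c₁ * N) = k * τ' t ^ 2 * N := by field_simp
      rw [e] at hlow'
      linarith)
  have hN : ∀ t ∈ Set.Ici (0 : ℝ), ‖q t‖ ^ 2 + ‖τ t • q' t‖ ^ 2 ≤ K / c₁ := fun t ht => by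
    rw [le_div_iff₀' hc₁0]
    exact (le_lyapunov α β (q t) (τ t • q' t)).trans (hK t ht)
  refine ⟨⟨√(K / c₁), fun t ht => Real.le_sqrt_of_sq_le ?_⟩,
    ⟨√(K / c₁) / τmin, fun t ht => (le_div_iff₀' hτmin).2 ?_⟩⟩
  · linarith [hN t ht, sq_nonneg ‖τ t • q' t‖]
  · calc τmin * ‖q' t‖ ≤ τ t * ‖q' t‖ := by gcongr; exact (hτbd t ht).1
      _ = ‖τ t • q' t‖ := by rw [norm_smul, Real.norm_of_nonneg (hτ0 t ht).le]
      _ ≤ √(K / c₁) := Real.le_sqrt_of_sq_le (by linarith [hN t ht, sq_nonneg ‖q t‖])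
end
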